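/- arXiv:1212.1884 — 3 statements merged into one kernel-verified Lean document; each statement's English description precedes it below -/
import Mathlib

section
/- Let 𝒢 be an n-player potential game with potential Φ and let P be the transition matrix of the logit dynamics for 𝒢 with inverse noise β ≥ 0. Then P is reversible with respect to the Gibbs measure π(x) = exp(−β·Φ(x))/Z, i.e. π(x)·P(x,y) = π(y)·P(y,x) for all profiles x, y ∈ S; consequently π is a stationary distribution of P, i.e. ∑_{x∈S} π(x)·P(x,y) = π(y) for every y ∈ S. -/
noncomputable section

open Finset

variable {n : ℕ} {S : Fin n → Type*} [∀ i, Fintype (S i)] [∀ i, DecidableEq (S i)]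
  [∀ i, Nonempty (S i)]

/-- Logit update probability `σ_i(z ∣ x)` with inverse noise `β` for the game with
utilities `u`. -/
def logitSigma (β : ℝ) (u : Fin n → (∀ i, S i) → ℝ) (i : Fin n) (z : S i)
    (x : ∀ i, S i) : ℝ :=
  Real.exp (β * u i (Function.update x i z)) /
    ∑ w : S i, Real.exp (β * u i (Function.update x i w))

/-- Transition matrix of the logit dynamics with inverse noise `β`:
`P x y = (1/n) · σ_i(y_i ∣ x)` if `x` and `y` differ exactly in coordinate `i`,
`P x x = (1/n) · ∑ i, σ_i(x_i ∣ x)`, and `P x y = 0` otherwise. -/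
def logitP (β : ℝ) (u : Fin n → (∀ i, S i) → ℝ) :
    Matrix (∀ i, S i) (∀ i, S i) ℝ := fun x y =>
  (1 / (n : ℝ)) *
    ∑ i, if y = Function.update x i (y i) then logitSigma β u i (y i) x else 0

/-- `Φ` is an (exact) potential for the game with utilities `u`. -/
def IsPotential (u : Fin n → (∀ i, S i) → ℝ) (Φ : (∀ i, S i) → ℝ) : Prop :=
  ∀ (i : Fin n) (a b : S i) (x : ∀ i, S i),
    u i (Function.update x i a) - u i (Function.update x i b) =
      Φ (Function.update x i b) - Φ (Function.update x i a)

/-- The Gibbs measure `π(x) = exp(−β·Φ(x))/Z`. -/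
def gibbs (β : ℝ) (Φ : (∀ i, S i) → ℝ) (x : ∀ i, S i) : ℝ :=
  Real.exp (-β * Φ x) / ∑ y : ∀ i, S i, Real.exp (-β * Φ y)

/-- Total variation distance `(1/2)·∑ z, |μ z − ν z|`. -/
def tvDist {α : Type*} [Fintype α] (μ ν : α → ℝ) : ℝ :=
  (1 / 2) * ∑ z, |μ z - ν z|

/-- Maximum global variation `ΔΦ = max Φ − min Φ`. -/
def maxVar (Φ : (∀ i, S i) → ℝ) : ℝ :=
  sSup {d : ℝ | ∃ x y : ∀ i, S i, d = Φ x - Φ y}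

/-- Two profiles are adjacent if they differ in exactly one coordinate. -/
def Adjacent (x y : ∀ i, S i) : Prop :=
  (Finset.univ.filter fun i => x i ≠ y i).card = 1

/-- Maximum local variation `δΦ`. -/
def localVar (Φ : (∀ i, S i) → ℝ) : ℝ :=
  sSup {d : ℝ | ∃ x y : ∀ i, S i, Adjacent x y ∧ d = Φ x - Φ y}

/-- In a potential game the logit update probability is the conditional Gibbs weight. -/
theorem logitSigma_eq_of_isPotential {u : Fin n → (∀ i, S i) → ℝ} {Φ : (∀ i, S i) → ℝ}
    (hpot : IsPotential u Φ) (β : ℝ) (i : Fin n) (z : S i) (x : ∀ i, S i) :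
    logitSigma β u i z x = Real.exp (-β * Φ (Function.update x i z)) /
      ∑ w : S i, Real.exp (-β * Φ (Function.update x i w)) := by
  have key : ∀ w : S i, Real.exp (β * u i (Function.update x i w)) =
      Real.exp (β * (u i x + Φ x)) * Real.exp (-β * Φ (Function.update x i w)) := by
    intro w
    have h := hpot i w (x i) x
    rw [Function.update_eq_self] at h
    rw [← Real.exp_add]
    congr 1
    linear_combination β * h
  unfold logitSigma
  simp only [key, ← Finset.mul_sum]
  exact mul_div_mul_left _ _ (Real.exp_pos _).ne'

/-- The logit update probabilities of a player sum to one. -/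
theorem sum_logitSigma (β : ℝ) (u : Fin n → (∀ i, S i) → ℝ) (i : Fin n) (x : ∀ i, S i) :
    ∑ z : S i, logitSigma β u i z x = 1 := by
  unfold logitSigma
  rw [← Finset.sum_div]
  exact div_self (Finset.sum_pos (fun _ _ => Real.exp_pos _) Finset.univ_nonempty).ne'

/-- The rows of the logit transition matrix sum to one. -/
theorem sum_logitP (hn : 1 ≤ n) (β : ℝ) (u : Fin n → (∀ i, S i) → ℝ) (x : ∀ i, S i) :
    ∑ y, logitP β u x y = 1 := by
  have key : ∀ i : Fin n, (∑ y : ∀ i, S i,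
      if y = Function.update x i (y i) then logitSigma β u i (y i) x else 0) = 1 := by
    intro i
    rw [← sum_logitSigma β u i x, ← Finset.sum_filter]
    refine Finset.sum_nbij' (fun y => y i) (fun z => Function.update x i z) ?_ ?_ ?_ ?_ ?_
    · simp
    · simp
    · intro y hy
      exact (Finset.mem_filter.mp hy).2.symm
    · simp
    · simp
  have hn' : (n : ℝ) ≠ 0 := by
    exact_mod_cast (Nat.one_le_iff_ne_zero.mp hn)
  unfold logitP
  rw [← Finset.mul_sum, Finset.sum_comm]
  simp [key, hn']

theorem eq_update_comm {ι : Type*} [DecidableEq ι] {α : ι → Type*} (x y : ∀ i, α i) (i : ι) :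
    y = Function.update x i (y i) ↔ x = Function.update y i (x i) := by
  simp only [Function.eq_update_iff, true_and, eq_comm]

/-- Detailed balance of the logit dynamics with respect to the Gibbs measure. -/
theorem gibbs_mul_logitP_comm {u : Fin n → (∀ i, S i) → ℝ} {Φ : (∀ i, S i) → ℝ}
    (hpot : IsPotential u Φ) (β : ℝ) (x y : ∀ i, S i) :
    gibbs β Φ x * logitP β u x y = gibbs β Φ y * logitP β u y x := by
  unfold logitP
  rw [mul_left_comm, mul_left_comm (gibbs β Φ y),
    Finset.mul_sum _ _ (gibbs β Φ x), Finset.mul_sum _ _ (gibbs β Φ y)]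
  refine congrArg _ (Finset.sum_congr rfl fun i _ => ?_)
  by_cases h : y = Function.update x i (y i)
  · have h' := (eq_update_comm x y i).mp h
    have hw : ∀ w : S i, Function.update y i w = Function.update x i w := by
      intro w
      rw [h, Function.update_idem]
    rw [if_pos h, if_pos h', logitSigma_eq_of_isPotential hpot,
      logitSigma_eq_of_isPotential hpot, ← h, ← h']
    simp only [hw, gibbs]
    ring
  · rw [if_neg h, if_neg (mt (eq_update_comm x y i).mpr h), mul_zero, mul_zero]

/-- For an `n`-player potential game with potential `Φ`, the logit dynamics
transition matrix `P` with inverse noise `β ≥ 0` is reversible with respect to the Gibbs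
measure `π(x) = exp(−β·Φ(x))/Z`, and consequently `π` is stationary for `P`. -/
theorem logit_reversible_and_stationary
    (hn : 1 ≤ n) (u : Fin n → (∀ i, S i) → ℝ) (Φ : (∀ i, S i) → ℝ)
    (hpot : IsPotential u Φ) (β : ℝ) (hβ : 0 ≤ β) :
    (∀ x y : ∀ i, S i,
        gibbs β Φ x * logitP β u x y = gibbs β Φ y * logitP β u y x) ∧
    (∀ y : ∀ i, S i, ∑ x, gibbs β Φ x * logitP β u x y = gibbs β Φ y) := by
  refine ⟨gibbs_mul_logitP_comm hpot β, fun y => ?_⟩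
  simp only [gibbs_mul_logitP_comm hpot β _ y]
  rw [← Finset.mul_sum, sum_logitP hn, mul_one]
end
end

section
/- Let 𝒢 be an n-player game and let P⁰ be the transition matrix of the logit dynamics for 𝒢 with inverse noise β = 0 (so that for every player i and every profile x, σ_i(z | x) = 1/|S_i| for each z ∈ S_i). Then every eigenvalue λ of P⁰ other than the top eigenvalue λ_1 = 1 satisfies |λ| ≤ 1 − 1/n; equivalently, the relaxation time t_rel = 1/(1 − λ*) satisfies t_rel ≤ n, where λ* is the largest absolute value among eigenvalues other than λ_1. -/
noncomputable section

open Finset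

variable {n : ℕ} {S : Fin n → Type*} [∀ i, Fintype (S i)] [∀ i, DecidableEq (S i)]
  [∀ i, Nonempty (S i)]

/-- A finite sum of commuting idempotent endomorphisms has only eigenvalues among the natural
numbers not exceeding the number of summands. -/
theorem exists_nat_eq_of_sum_idempotent_apply_eq_smul {ι K V : Type*} [DecidableEq ι] [Field K]
    [AddCommGroup V] [Module K V] (A : ι → Module.End K V)
    (hidem : ∀ i, IsIdempotentElem (A i)) (hcomm : ∀ i j, Commute (A i) (A j))
    (s : Finset ι) (μ : K) (v : V) (hv : v ≠ 0) (h : (∑ i ∈ s, A i) v = μ • v) :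
    ∃ k : ℕ, k ≤ s.card ∧ μ = k := by
  induction s using Finset.induction_on generalizing μ v with
  | empty =>
    refine ⟨0, le_rfl, ?_⟩
    simpa [hv, eq_comm] using h
  | insert a s ha ih =>
    rw [Finset.sum_insert ha, LinearMap.add_apply] at h
    rw [Finset.card_insert_of_notMem ha]
    by_cases h0 : A a v = 0
    · obtain ⟨k, hk, rfl⟩ := ih μ v hv (by rwa [h0, zero_add] at h)
      exact ⟨k, by lia, rfl⟩
    · have hself : A a (A a v) = A a v := DFunLike.congr_fun (hidem a) v
      have hswap : (∑ i ∈ s, A i) (A a v) = A a ((∑ i ∈ s, A i) v) :=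
        DFunLike.congr_fun (Commute.sum_left s A (A a) fun i _ => hcomm i a) v
      have hmap := congrArg (A a) h
      rw [map_add, hself, map_smul, ← hswap] at hmap
      obtain ⟨k, hk, hμ⟩ := ih (μ - 1) (A a v) h0 (by
        rw [sub_smul, one_smul, ← hmap, add_sub_cancel_left])
      exact ⟨k + 1, by lia, by rw [Nat.cast_succ, ← hμ, sub_add_cancel]⟩

/-- The operator replacing a function by its average over the `i`-th coordinate. -/
def coordAverage (S : Fin n → Type*) [∀ i, Fintype (S i)] (i : Fin n) :
    Module.End ℝ ((∀ i, S i) → ℝ) where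
  toFun v x := (Fintype.card (S i) : ℝ)⁻¹ * ∑ w : S i, v (Function.update x i w)
  map_add' v w := by
    ext x
    simp [Finset.sum_add_distrib, mul_add]
  map_smul' c v := by
    ext x
    simp [← Finset.mul_sum, mul_left_comm]

theorem coordAverage_apply {S : Fin n → Type*} [∀ i, Fintype (S i)] (i : Fin n)
    (v : (∀ i, S i) → ℝ) (x : ∀ i, S i) :
    coordAverage S i v x =
      (Fintype.card (S i) : ℝ)⁻¹ * ∑ w : S i, v (Function.update x i w) := rfl

theorem coordAverage_isIdempotentElem {S : Fin n → Type*} [∀ i, Fintype (S i)]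
    [∀ i, Nonempty (S i)] (i : Fin n) : IsIdempotentElem (coordAverage S i) := by
  refine LinearMap.ext fun v => funext fun x => ?_
  have hc : (Fintype.card (S i) : ℝ) ≠ 0 := Nat.cast_ne_zero.mpr Fintype.card_ne_zero
  simp [coordAverage_apply, Module.End.mul_apply, hc]

theorem coordAverage_commute {S : Fin n → Type*} [∀ i, Fintype (S i)] (i j : Fin n) :
    Commute (coordAverage S i) (coordAverage S j) := by
  rcases eq_or_ne i j with rfl | hij
  · exact Commute.refl _
  refine LinearMap.ext fun v => funext fun x => ?_
  simp only [coordAverage_apply, Module.End.mul_apply, ← Finset.mul_sum]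
  rw [Finset.sum_comm, mul_left_comm]
  simp_rw [Function.update_comm hij]

theorem sum_ite_eq_update {S : Fin n → Type*} [∀ i, Fintype (S i)] [∀ i, DecidableEq (S i)]
    (i : Fin n) (x : ∀ i, S i) (f : (∀ i, S i) → ℝ) :
    (∑ y, if y = Function.update x i (y i) then f y else 0) =
      ∑ w : S i, f (Function.update x i w) := by
  rw [← Finset.sum_filter]
  refine Finset.sum_nbij' (fun y => y i) (fun w => Function.update x i w) ?_ ?_ ?_ ?_ ?_
  · simp
  · simp
  · intro y hy
    exact (Finset.mem_filter.mp hy).2.symm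
  · simp
  · intro y hy
    exact congrArg f (Finset.mem_filter.mp hy).2

theorem logitP_zero_mulVec {S : Fin n → Type*} [∀ i, Fintype (S i)] [∀ i, DecidableEq (S i)]
    (u : Fin n → (∀ i, S i) → ℝ) (v : (∀ i, S i) → ℝ) :
    (logitP 0 u).mulVec v = (1 / (n : ℝ)) • (∑ i, coordAverage S i) v := by
  ext x
  simp only [Matrix.mulVec, dotProduct, logitP, logitSigma, zero_mul, Real.exp_zero,
    Finset.sum_const, Finset.card_univ, nsmul_eq_mul, mul_one, mul_assoc, Finset.sum_mul,
    ite_mul, ← Finset.mul_sum, Pi.smul_apply, smul_eq_mul, LinearMap.sum_apply,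
    Finset.sum_apply, coordAverage_apply]
  rw [Finset.sum_comm]
  simp_rw [sum_ite_eq_update, Finset.mul_sum, one_div]

/-- For the logit dynamics with inverse noise `β = 0` of any `n`-player
game, every eigenvalue `λ` other than the top eigenvalue `1` satisfies `|λ| ≤ 1 − 1/n`;
equivalently the relaxation time satisfies `t_rel ≤ n`. -/
theorem logit_beta_zero_relaxation
    (hn : 1 ≤ n) (u : Fin n → (∀ i, S i) → ℝ) :
    ∀ (lam : ℝ) (v : (∀ i, S i) → ℝ), v ≠ 0 →
      (logitP 0 u).mulVec v = lam • v → lam ≠ 1 →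
      |lam| ≤ 1 - 1 / (n : ℝ) := by
  intro lam v hv h hlam
  have hn0 : (0 : ℝ) < n := by exact_mod_cast hn
  rw [logitP_zero_mulVec] at h
  obtain ⟨k, hk, hμ⟩ := exists_nat_eq_of_sum_idempotent_apply_eq_smul (coordAverage S)
    coordAverage_isIdempotentElem coordAverage_commute Finset.univ (n * lam) v hv (by
      rw [mul_smul, ← h, smul_smul, mul_one_div_cancel hn0.ne', one_smul])
  rw [Finset.card_univ, Fintype.card_fin] at hk
  have hlam_eq : lam = k / n := by rw [← hμ, mul_div_cancel_left₀ _ hn0.ne']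
  have hkn : k ≠ n := by
    rintro rfl
    exact hlam (by rw [hlam_eq, div_self hn0.ne'])
  have hk1 : (k : ℝ) + 1 ≤ n := by exact_mod_cast lt_of_le_of_ne hk hkn
  rw [hlam_eq, abs_of_nonneg (by positivity), le_sub_iff_add_le, ← add_div]
  exact (div_le_one hn0).mpr hk1
end
end

section
/- Let 𝒢 be an n-player potential game with potential Φ where each player has at most m strategies, let ΔΦ be the maximum global variation of Φ, and let P be the transition matrix of the logit dynamics for 𝒢 with inverse noise β ≥ 0, with Gibbs stationary measure π. Then for every ε ∈ (0,1) and every integer t ≥ 2·m·n·e^{β·ΔΦ}·(ln(1/ε) + β·ΔΦ + n·ln m), one has ‖P^t(x,·) − π‖_TV ≤ ε for every starting profile x ∈ S. -/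
noncomputable section

open Finset

variable {n : ℕ} {S : Fin n → Type*} [∀ i, Fintype (S i)] [∀ i, DecidableEq (S i)]
  [∀ i, Nonempty (S i)]

set_option linter.unusedSectionVars false

/-- Average of `f` over the `i`-th coordinate with respect to the positive weight `w`, the other
coordinates being held fixed: the conditional expectation of `f` given `x_{-i}`. -/
def coordAvg (w : (∀ i, S i) → ℝ) (i : Fin n) (f : (∀ i, S i) → ℝ) (x : ∀ i, S i) : ℝ :=
  (∑ z : S i, w (Function.update x i z) * f (Function.update x i z)) /
    ∑ z : S i, w (Function.update x i z)

lemma coordAvg_update (w : (∀ i, S i) → ℝ) (i : Fin n) (f : (∀ i, S i) → ℝ) (x : ∀ i, S i)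
    (a : S i) : coordAvg w i f (Function.update x i a) = coordAvg w i f x := by
  simp [coordAvg]

/-- Averaging along coordinate `i` preserves independence of any coordinate `j`
for the constant weight. -/
lemma coordAvg_one_update_of_update (i j : Fin n) (f : (∀ i, S i) → ℝ)
    (hf : ∀ x a, f (Function.update x j a) = f x) (x : ∀ i, S i) (a : S j) :
    coordAvg 1 i f (Function.update x j a) = coordAvg 1 i f x := by
  rcases eq_or_ne i j with rfl | hij
  · exact coordAvg_update 1 i f x a
  · simp [coordAvg, Function.update_comm hij.symm, hf]

lemma sum_sum_update_swap (i : Fin n) (K : (∀ i, S i) → (∀ i, S i) → ℝ) :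
    ∑ x, ∑ z : S i, K x (Function.update x i z) = ∑ x, ∑ z : S i, K (Function.update x i z) x := by
  rw [← Fintype.sum_prod_type' (fun x (z : S i) => K x (Function.update x i z)),
    ← Fintype.sum_prod_type' (fun x (z : S i) => K (Function.update x i z) x)]
  have hinv : Function.Involutive
      (fun p : (∀ i, S i) × S i => (Function.update p.1 i p.2, p.1 i)) := fun p => by simp
  exact Fintype.sum_equiv hinv.toPerm _ _ fun p => by simp [Function.Involutive.toPerm]

/-- The weighted average along a coordinate is an orthogonal projection in `L²(w)`. -/
lemma sum_mul_coordAvg {w : (∀ i, S i) → ℝ} (hw : ∀ x, 0 < w x) (i : Fin n)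
    (f g : (∀ i, S i) → ℝ) (hg : ∀ x a, g (Function.update x i a) = g x) :
    ∑ x, w x * (g x * coordAvg w i f x) = ∑ x, w x * (g x * f x) := by
  have key := sum_sum_update_swap i fun x y =>
    w x * g x * (w y * f y) / ∑ z : S i, w (Function.update x i z)
  simp only [Function.update_idem, hg] at key
  calc ∑ x, w x * (g x * coordAvg w i f x)
      = ∑ x, ∑ z : S i, w x * g x * (w (Function.update x i z) * f (Function.update x i z)) /
          ∑ z : S i, w (Function.update x i z) := by
        refine Finset.sum_congr rfl fun x _ => ?_
        rw [coordAvg, ← Finset.sum_div, ← Finset.mul_sum]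
        ring
    _ = _ := key
    _ = ∑ x, w x * (g x * f x) := by
        refine Finset.sum_congr rfl fun x _ => ?_
        have hpos : 0 < ∑ z : S i, w (Function.update x i z) :=
          Finset.sum_pos (fun z _ => hw _) Finset.univ_nonempty
        rw [← Finset.sum_div, div_eq_iff hpos.ne', Finset.mul_sum]
        exact Finset.sum_congr rfl fun z _ => by ring

/-- Pythagoras for the averaging operator along a coordinate. -/
lemma sum_sq_sub_eq_add {w : (∀ i, S i) → ℝ} (hw : ∀ x, 0 < w x) (i : Fin n)
    (f g : (∀ i, S i) → ℝ) (hg : ∀ x a, g (Function.update x i a) = g x) :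
    ∑ x, w x * (f x - g x) ^ 2 =
      ∑ x, w x * (f x - coordAvg w i f x) ^ 2 + ∑ x, w x * (coordAvg w i f x - g x) ^ 2 := by
  have h := sum_mul_coordAvg hw i f (fun x => coordAvg w i f x - g x)
    fun x a => by rw [coordAvg_update, hg]
  rw [← sub_eq_zero, ← Finset.sum_sub_distrib] at h
  rw [← sub_eq_zero, ← Finset.sum_add_distrib, ← Finset.sum_sub_distrib,
    ← mul_zero (-2 : ℝ), ← h, Finset.mul_sum]
  exact Finset.sum_congr rfl fun x _ => by ring

lemma sum_sq_coordAvg_le {w : (∀ i, S i) → ℝ} (hw : ∀ x, 0 < w x) (i : Fin n)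
    (f : (∀ i, S i) → ℝ) :
    ∑ x, w x * coordAvg w i f x ^ 2 ≤ ∑ x, w x * f x ^ 2 := by
  have h := sum_sq_sub_eq_add hw i f (fun _ => 0) fun _ _ => rfl
  simp only [sub_zero] at h
  rw [h]
  exact le_add_of_nonneg_left
    (Finset.sum_nonneg fun x _ => mul_nonneg (hw x).le (sq_nonneg _))

lemma coordAvg_sub (w : (∀ i, S i) → ℝ) (i : Fin n) (f g : (∀ i, S i) → ℝ) (x : ∀ i, S i) :
    coordAvg w i (fun x => f x - g x) x = coordAvg w i f x - coordAvg w i g x := by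
  simp only [coordAvg, mul_sub, Finset.sum_sub_distrib, sub_div]

lemma coordAvg_eq_self {w : (∀ i, S i) → ℝ} (hw : ∀ x, 0 < w x) (i : Fin n)
    (f : (∀ i, S i) → ℝ) (hf : ∀ x a, f (Function.update x i a) = f x) (x : ∀ i, S i) :
    coordAvg w i f x = f x := by
  have hpos : 0 < ∑ z : S i, w (Function.update x i z) :=
    Finset.sum_pos (fun z _ => hw _) Finset.univ_nonempty
  simp only [coordAvg, hf]
  rw [← Finset.sum_mul, mul_div_cancel_left₀ _ hpos.ne']

/-- Efron–Stein inequality for the uniform measure, one set of coordinates at a time. -/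
lemma exists_update_invariant_sum_sq_le (f : (∀ i, S i) → ℝ) (s : Finset (Fin n)) :
    ∃ g : (∀ i, S i) → ℝ, (∀ i ∈ s, ∀ x a, g (Function.update x i a) = g x) ∧
      ∑ x, (f x - g x) ^ 2 ≤ ∑ i ∈ s, ∑ x, (f x - coordAvg 1 i f x) ^ 2 := by
  induction s using Finset.induction_on with
  | empty => exact ⟨f, by simp, by simp⟩
  | insert i s hi ih =>
    obtain ⟨g, hg, hle⟩ := ih
    refine ⟨coordAvg 1 i g, fun j hj x a => ?_, ?_⟩
    · rcases Finset.mem_insert.1 hj with rfl | hj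
      · exact coordAvg_update 1 j g x a
      · exact coordAvg_one_update_of_update i j g (hg j hj) x a
    · have hone : ∀ x : ∀ i, S i, 0 < (1 : (∀ i, S i) → ℝ) x := fun _ => one_pos
      have h1 := sum_sq_sub_eq_add hone i f (coordAvg 1 i g) (coordAvg_update 1 i g)
      have h2 := sum_sq_coordAvg_le hone i fun x => f x - g x
      simp only [coordAvg_sub, Pi.one_apply, one_mul] at h1 h2
      rw [Finset.sum_insert hi, h1]
      linarith

lemma eq_of_update_invariant (g : (∀ i, S i) → ℝ)
    (hg : ∀ i x a, g (Function.update x i a) = g x) (x y : ∀ i, S i) : g x = g y := by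
  have h : ∀ s : Finset (Fin n), g (s.piecewise x y) = g y := by
    intro s
    induction s using Finset.induction_on with
    | empty => simp
    | insert i s _ ih => rw [Finset.piecewise_insert, hg, ih]
  simpa using h Finset.univ

/-- Poincaré inequality for a weight whose values have ratios at most `R`. -/
lemma sum_sq_le_of_sum_eq_zero {w : (∀ i, S i) → ℝ} (hw : ∀ x, 0 < w x) {R : ℝ}
    (hR : ∀ x y, w x ≤ R * w y) (f : (∀ i, S i) → ℝ) (hf : ∑ x, w x * f x = 0) :
    ∑ x, w x * f x ^ 2 ≤ R * ∑ i, ∑ x, w x * (f x - coordAvg w i f x) ^ 2 := by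
  obtain ⟨g, hg, hle⟩ := exists_update_invariant_sum_sq_le f Finset.univ
  obtain ⟨y, hy⟩ := Finite.exists_min w
  have hR0 : 0 ≤ R := nonneg_of_mul_nonneg_left ((hw y).le.trans (hR y y)) (hw y)
  have hconst : ∀ x, g x = g y := fun x =>
    eq_of_update_invariant g (fun i => hg i (Finset.mem_univ i)) x y
  have hone : ∀ x : ∀ i, S i, 0 < (1 : (∀ i, S i) → ℝ) x := fun _ => one_pos
  calc ∑ x, w x * f x ^ 2
      ≤ ∑ x, w x * (f x - g x) ^ 2 := by
        have h : ∑ x, w x * (f x - g x) ^ 2 =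
            ∑ x, w x * f x ^ 2 - 2 * g y * ∑ x, w x * f x + ∑ x, w x * g y ^ 2 := by
          rw [Finset.mul_sum, ← Finset.sum_sub_distrib, ← Finset.sum_add_distrib]
          exact Finset.sum_congr rfl fun x _ => by rw [hconst x]; ring
        rw [h, hf, mul_zero, sub_zero]
        exact le_add_of_nonneg_right
          (Finset.sum_nonneg fun x _ => mul_nonneg (hw x).le (sq_nonneg _))
    _ ≤ R * w y * ∑ x, (f x - g x) ^ 2 := by
        rw [Finset.mul_sum]
        exact Finset.sum_le_sum fun x _ => mul_le_mul_of_nonneg_right (hR x y) (sq_nonneg _)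
    _ ≤ R * w y * ∑ i, ∑ x, (f x - coordAvg w i f x) ^ 2 := by
        refine mul_le_mul_of_nonneg_left (hle.trans (Finset.sum_le_sum fun i _ => ?_))
          (mul_nonneg hR0 (hw y).le)
        have h := sum_sq_sub_eq_add hone i f (coordAvg w i f) (coordAvg_update w i f)
        simp only [Pi.one_apply, one_mul] at h
        rw [h]
        exact le_add_of_nonneg_right (Finset.sum_nonneg fun x _ => sq_nonneg _)
    _ ≤ R * ∑ i, ∑ x, w x * (f x - coordAvg w i f x) ^ 2 := by
        rw [mul_assoc, Finset.mul_sum]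
        refine mul_le_mul_of_nonneg_left (Finset.sum_le_sum fun i _ => ?_) hR0
        rw [Finset.mul_sum]
        exact Finset.sum_le_sum fun x _ => mul_le_mul_of_nonneg_right (hy x) (sq_nonneg _)

/-- One step of Glauber dynamics contracts the squared `L²(w)` norm of centred functions. -/
lemma sum_sq_avg_coordAvg_le (hn : 1 ≤ n) {w : (∀ i, S i) → ℝ} (hw : ∀ x, 0 < w x) {R : ℝ}
    (hR : ∀ x y, w x ≤ R * w y) (f : (∀ i, S i) → ℝ) (hf : ∑ x, w x * f x = 0) :
    ∑ x, w x * (1 / (n : ℝ) * ∑ i, coordAvg w i f x) ^ 2 ≤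
      (1 - 1 / (n * R)) * ∑ x, w x * f x ^ 2 := by
  have hn0 : (0 : ℝ) < n := by exact_mod_cast hn
  obtain ⟨y⟩ : Nonempty (∀ i, S i) := inferInstance
  have hR0 : 0 < R := pos_of_mul_pos_left ((hw y).trans_le (hR y y)) (hw y).le
  have hP := sum_sq_le_of_sum_eq_zero hw hR f hf
  have hpyth : ∀ i, ∑ x, w x * (f x - coordAvg w i f x) ^ 2 =
      ∑ x, w x * f x ^ 2 - ∑ x, w x * coordAvg w i f x ^ 2 := fun i => by
    have h := sum_sq_sub_eq_add hw i f (fun _ => 0) fun _ _ => rfl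
    simp only [sub_zero] at h
    rw [h, add_sub_cancel_right]
  simp only [hpyth, Finset.sum_sub_distrib, Finset.sum_const, Finset.card_univ,
    Fintype.card_fin, nsmul_eq_mul] at hP
  have hJ : ∑ x, w x * (1 / (n : ℝ) * ∑ i, coordAvg w i f x) ^ 2 ≤
      1 / (n : ℝ) * ∑ i, ∑ x, w x * coordAvg w i f x ^ 2 := by
    rw [Finset.sum_comm, Finset.mul_sum]
    refine Finset.sum_le_sum fun x _ => ?_
    have h := sq_sum_le_card_mul_sum_sq (s := Finset.univ) (f := fun i => coordAvg w i f x)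
    rw [Finset.card_univ, Fintype.card_fin] at h
    rw [← Finset.mul_sum, mul_left_comm]
    refine mul_le_mul_of_nonneg_left ?_ (hw x).le
    rw [mul_pow]
    calc (1 / (n : ℝ)) ^ 2 * (∑ i, coordAvg w i f x) ^ 2
        ≤ (1 / (n : ℝ)) ^ 2 * (n * ∑ i, coordAvg w i f x ^ 2) := by gcongr
      _ = 1 / (n : ℝ) * ∑ i, coordAvg w i f x ^ 2 := by field_simp
  refine hJ.trans ?_
  rw [mul_comm, ← sub_nonneg] at hP
  generalize ∑ x, w x * f x ^ 2 = A at *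
  generalize ∑ i, ∑ x, w x * coordAvg w i f x ^ 2 = B at *
  rw [← sub_nonneg]
  have : (1 - 1 / (n * R)) * A - 1 / (n : ℝ) * B = ((n * A - B) * R - A) / (n * R) := by
    field_simp
    ring
  rw [this]
  positivity

lemma logitSigma_eq {u : Fin n → (∀ i, S i) → ℝ} {Φ : (∀ i, S i) → ℝ} (hpot : IsPotential u Φ)
    (β : ℝ) (i : Fin n) (z : S i) (x : ∀ i, S i) :
    logitSigma β u i z x = Real.exp (-β * Φ (Function.update x i z)) /
      ∑ a : S i, Real.exp (-β * Φ (Function.update x i a)) := by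
  set c := u i (Function.update x i z) + Φ (Function.update x i z) with hc
  have h : ∀ a : S i, Real.exp (β * u i (Function.update x i a)) =
      Real.exp (β * c) * Real.exp (-β * Φ (Function.update x i a)) := fun a => by
    rw [← Real.exp_add]
    have := hpot i a z x
    congr 1
    rw [hc]
    linear_combination β * this
  simp only [logitSigma, h]
  rw [← Finset.mul_sum, mul_div_mul_left _ _ (Real.exp_pos _).ne']

lemma logitP_mulVec {u : Fin n → (∀ i, S i) → ℝ} {Φ : (∀ i, S i) → ℝ} (hpot : IsPotential u Φ)
    (β : ℝ) (f : (∀ i, S i) → ℝ) (x : ∀ i, S i) :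
    (logitP β u).mulVec f x =
      1 / (n : ℝ) * ∑ i, coordAvg (fun y => Real.exp (-β * Φ y)) i f x := by
  simp only [Matrix.mulVec, dotProduct, logitP, mul_assoc, Finset.sum_mul]
  rw [← Finset.mul_sum, Finset.sum_comm]
  congr 1
  refine Finset.sum_congr rfl fun i _ => ?_
  simp only [ite_mul, zero_mul]
  rw [← Finset.sum_filter, coordAvg, Finset.sum_div]
  refine Finset.sum_bij' (fun y _ => y i) (fun z _ => Function.update x i z) ?_ ?_ ?_ ?_ ?_
  · simp
  · simp
  · intro y hy
    exact (Finset.mem_filter.1 hy).2.symm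
  · simp
  · intro y hy
    rw [logitSigma_eq hpot, ← (Finset.mem_filter.1 hy).2]
    ring

lemma sum_mul_logitP_mulVec (hn : 1 ≤ n) {u : Fin n → (∀ i, S i) → ℝ} {Φ : (∀ i, S i) → ℝ}
    (hpot : IsPotential u Φ) (β : ℝ) (f : (∀ i, S i) → ℝ) :
    ∑ x, Real.exp (-β * Φ x) * (logitP β u).mulVec f x = ∑ x, Real.exp (-β * Φ x) * f x := by
  have hn0 : (n : ℝ) ≠ 0 := by exact_mod_cast (Nat.pos_of_ne_zero (by omega)).ne'
  have h : ∀ i, ∑ x, Real.exp (-β * Φ x) * coordAvg (fun y => Real.exp (-β * Φ y)) i f x =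
      ∑ x, Real.exp (-β * Φ x) * f x := fun i => by
    simpa using sum_mul_coordAvg (w := fun y => Real.exp (-β * Φ y))
      (fun _ => Real.exp_pos _) i f (fun _ => 1) fun _ _ => rfl
  simp only [logitP_mulVec hpot, mul_left_comm _ (1 / (n : ℝ)), Finset.mul_sum]
  rw [← Finset.sum_comm]
  simp only [← Finset.mul_sum, h]
  simp [hn0]

lemma logitP_mulVec_const (hn : 1 ≤ n) {u : Fin n → (∀ i, S i) → ℝ} {Φ : (∀ i, S i) → ℝ}
    (hpot : IsPotential u Φ) (β c : ℝ) :
    (logitP β u).mulVec (fun _ => c) = fun _ => c := by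
  have hn0 : (n : ℝ) ≠ 0 := by exact_mod_cast (Nat.pos_of_ne_zero (by omega)).ne'
  funext x
  rw [logitP_mulVec hpot]
  simp only [coordAvg_eq_self (w := fun y => Real.exp (-β * Φ y)) (fun _ => Real.exp_pos _) _
    (fun _ => c) fun _ _ => rfl]
  simp [hn0]

lemma logitP_pow_mulVec_const (hn : 1 ≤ n) {u : Fin n → (∀ i, S i) → ℝ} {Φ : (∀ i, S i) → ℝ}
    (hpot : IsPotential u Φ) (β c : ℝ) (t : ℕ) :
    (logitP β u ^ t).mulVec (fun _ => c) = fun _ => c := by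
  induction t with
  | zero => simp
  | succ t ih => rw [pow_succ, ← Matrix.mulVec_mulVec, logitP_mulVec_const hn hpot, ih]

lemma sub_le_maxVar (Φ : (∀ i, S i) → ℝ) (x y : ∀ i, S i) : Φ x - Φ y ≤ maxVar Φ := by
  refine le_csSup ?_ ⟨x, y, rfl⟩
  refine ((Set.finite_range fun p : (∀ i, S i) × (∀ i, S i) => Φ p.1 - Φ p.2).subset ?_).bddAbove
  rintro _ ⟨a, b, rfl⟩
  exact ⟨(a, b), rfl⟩

lemma exp_le_exp_maxVar_mul (Φ : (∀ i, S i) → ℝ) {β : ℝ} (hβ : 0 ≤ β) (x y : ∀ i, S i) :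
    Real.exp (-β * Φ x) ≤ Real.exp (β * maxVar Φ) * Real.exp (-β * Φ y) := by
  rw [← Real.exp_add, Real.exp_le_exp]
  nlinarith [sub_le_maxVar Φ y x]

lemma sum_sq_logitP_pow_mulVec_le (hn : 1 ≤ n) {u : Fin n → (∀ i, S i) → ℝ}
    {Φ : (∀ i, S i) → ℝ} (hpot : IsPotential u Φ) {β : ℝ} (hβ : 0 ≤ β) (f : (∀ i, S i) → ℝ)
    (hf : ∑ x, Real.exp (-β * Φ x) * f x = 0) (t : ℕ) :
    ∑ x, Real.exp (-β * Φ x) * (logitP β u ^ t).mulVec f x ^ 2 ≤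
      Real.exp (-(t / (n * Real.exp (β * maxVar Φ)))) * ∑ x, Real.exp (-β * Φ x) * f x ^ 2 := by
  induction t generalizing f with
  | zero => simp
  | succ t ih =>
    rw [pow_succ, ← Matrix.mulVec_mulVec]
    refine (ih _ ((sum_mul_logitP_mulVec hn hpot β f).trans hf)).trans ?_
    have hstep := sum_sq_avg_coordAvg_le hn (w := fun y => Real.exp (-β * Φ y))
      (fun _ => Real.exp_pos _) (exp_le_exp_maxVar_mul Φ hβ) f hf
    simp only [← logitP_mulVec hpot] at hstep
    set D := (n : ℝ) * Real.exp (β * maxVar Φ)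
    have hA : 0 ≤ ∑ x, Real.exp (-β * Φ x) * f x ^ 2 := Finset.sum_nonneg fun x _ => by positivity
    have hexp : 1 - 1 / D ≤ Real.exp (-(1 / D)) := by
      linarith [Real.add_one_le_exp (-(1 / D))]
    have hsplit : Real.exp (-((t + 1 : ℕ) / D)) = Real.exp (-(t / D)) * Real.exp (-(1 / D)) := by
      rw [← Real.exp_add]
      congr 1
      push_cast
      ring
    rw [hsplit, mul_assoc]
    exact mul_le_mul_of_nonneg_left (hstep.trans (mul_le_mul_of_nonneg_right hexp hA))
      (Real.exp_pos _).le

/-- Pointwise convergence of the logit dynamics to the Gibbs measure. -/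
lemma abs_logitP_pow_sub_gibbs_le (hn : 1 ≤ n) {u : Fin n → (∀ i, S i) → ℝ}
    {Φ : (∀ i, S i) → ℝ} (hpot : IsPotential u Φ) {β : ℝ} (hβ : 0 ≤ β) (t : ℕ)
    (x y : ∀ i, S i) :
    |(logitP β u ^ t) x y - gibbs β Φ y| ≤
      Real.exp ((β * maxVar Φ - t / (n * Real.exp (β * maxVar Φ))) / 2) := by
  set p := gibbs β Φ y with hp
  set f : (∀ i, S i) → ℝ := Pi.single y 1 - fun _ => p with hfdef
  have hZ : 0 < ∑ z : ∀ i, S i, Real.exp (-β * Φ z) :=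
    Finset.sum_pos (fun _ _ => Real.exp_pos _) Finset.univ_nonempty
  have hpZ : p * ∑ z : ∀ i, S i, Real.exp (-β * Φ z) = Real.exp (-β * Φ y) := by
    rw [hp, gibbs, div_mul_cancel₀ _ hZ.ne']
  have hsingle : ∑ z, Real.exp (-β * Φ z) * (Pi.single y (1 : ℝ) : (∀ i, S i) → ℝ) z =
      Real.exp (-β * Φ y) := by
    simp [Pi.single_apply]
  have hf : ∑ z, Real.exp (-β * Φ z) * f z = 0 := by
    simp only [hfdef, Pi.sub_apply, mul_sub, Finset.sum_sub_distrib]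
    rw [hsingle, ← Finset.sum_mul, mul_comm _ p, hpZ, sub_self]
  have hfsq : ∑ z, Real.exp (-β * Φ z) * f z ^ 2 ≤ Real.exp (-β * Φ y) := by
    have h : ∀ z, f z ^ 2 = (1 - p) * (Pi.single y (1 : ℝ) : (∀ i, S i) → ℝ) z - p * f z := by
      intro z
      by_cases hz : z = y
      · subst hz
        simp [hfdef]
        ring
      · simp [hfdef, Pi.single_eq_of_ne hz]
        ring
    simp only [h, mul_sub, Finset.sum_sub_distrib, mul_left_comm _ (1 - p), mul_left_comm _ p]
    rw [← Finset.mul_sum, ← Finset.mul_sum, hsingle, hf]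
    have hp0 : 0 ≤ p := div_nonneg (Real.exp_pos _).le hZ.le
    nlinarith [Real.exp_pos (-β * Φ y)]
  have hval : (logitP β u ^ t).mulVec f x = (logitP β u ^ t) x y - p := by
    rw [hfdef, Matrix.mulVec_sub, logitP_pow_mulVec_const hn hpot]
    simp
  have hmain := sum_sq_logitP_pow_mulVec_le hn hpot hβ f hf t
  have hx := Finset.single_le_sum
    (f := fun z => Real.exp (-β * Φ z) * (logitP β u ^ t).mulVec f z ^ 2)
    (fun z _ => by positivity) (Finset.mem_univ x)
  simp only [hval] at hx
  have hratio := exp_le_exp_maxVar_mul Φ hβ y x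
  set a := β * maxVar Φ
  set b := (t : ℝ) / (n * Real.exp a)
  refine abs_le_of_sq_le_sq ?_ (Real.exp_pos _).le
  have hsq : Real.exp ((a - b) / 2) ^ 2 = Real.exp (-b) * Real.exp a := by
    rw [← Real.exp_nat_mul, ← Real.exp_add]
    congr 1
    push_cast
    ring
  rw [hsq]
  refine le_of_mul_le_mul_left ?_ (Real.exp_pos (-β * Φ x))
  calc _ ≤ _ := hx
    _ ≤ _ := hmain
    _ ≤ Real.exp (-b) * (Real.exp a * Real.exp (-β * Φ x)) :=
        mul_le_mul_of_nonneg_left (hfsq.trans hratio) (Real.exp_pos _).le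
    _ = _ := by ring

/-- Mixing time upper bound for potential games, for all `β ≥ 0`:
after `t ≥ 2·m·n·e^{β·ΔΦ}·(ln(1/ε) + β·ΔΦ + n·ln m)` steps the chain is within total
variation distance `ε` of the Gibbs measure, from every starting profile. -/
theorem logit_mixing_upper_bound_all_beta
    (hn : 1 ≤ n) (m : ℕ) (hm : ∀ i, Fintype.card (S i) ≤ m)
    (u : Fin n → (∀ i, S i) → ℝ) (Φ : (∀ i, S i) → ℝ)
    (hpot : IsPotential u Φ) (β : ℝ) (hβ : 0 ≤ β) :
    ∀ ε : ℝ, 0 < ε → ε < 1 → ∀ t : ℕ,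
      2 * (m : ℝ) * (n : ℝ) * Real.exp (β * maxVar Φ) *
          (Real.log (1 / ε) + β * maxVar Φ + (n : ℝ) * Real.log (m : ℝ)) ≤ (t : ℝ) →
      ∀ x : ∀ i, S i, tvDist ((logitP β u ^ t) x) (gibbs β Φ) ≤ ε := by
  intro ε hε hε1 t ht x
  have hn0 : (0 : ℝ) < n := by exact_mod_cast hn
  have hm1 : 1 ≤ m := Fintype.card_pos.trans_le (hm ⟨0, hn⟩)
  have hm1' : (1 : ℝ) ≤ m := by exact_mod_cast hm1
  have hcard : (Fintype.card (∀ i, S i) : ℝ) ≤ Real.exp (n * Real.log m) := by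
    rw [Real.exp_nat_mul, Real.exp_log (by linarith), Fintype.card_pi]
    have h : ∏ i, Fintype.card (S i) ≤ m ^ n := by
      simpa using Finset.prod_le_pow_card Finset.univ _ m fun i _ => hm i
    exact_mod_cast h
  have ha : 0 ≤ β * maxVar Φ := mul_nonneg hβ (by simpa using sub_le_maxVar Φ x x)
  have hlogε : 0 ≤ Real.log (1 / ε) := Real.log_nonneg (by rw [le_div_iff₀ hε]; linarith)
  have hlogm : 0 ≤ (n : ℝ) * Real.log m := mul_nonneg hn0.le (Real.log_nonneg hm1')
  have hpt := abs_logitP_pow_sub_gibbs_le hn hpot hβ t x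
  set a := β * maxVar Φ
  set b := (t : ℝ) / (n * Real.exp a) with hb
  have hbL : 2 * (Real.log (1 / ε) + a + n * Real.log m) ≤ b := by
    rw [hb, le_div_iff₀ (mul_pos hn0 (Real.exp_pos _))]
    refine le_trans ?_ ht
    have hL : 0 ≤ 2 * (n : ℝ) * Real.exp a * (Real.log (1 / ε) + a + n * Real.log m) := by
      positivity
    nlinarith [mul_le_mul_of_nonneg_right hm1' hL]
  calc tvDist ((logitP β u ^ t) x) (gibbs β Φ)
      ≤ 1 / 2 * ∑ _y : ∀ i, S i, Real.exp ((a - b) / 2) := by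
        unfold tvDist
        gcongr with y
        exact hpt y
    _ ≤ Fintype.card (∀ i, S i) * Real.exp ((a - b) / 2) := by
        rw [Finset.sum_const, Finset.card_univ, nsmul_eq_mul]
        have : 0 ≤ (Fintype.card (∀ i, S i) : ℝ) * Real.exp ((a - b) / 2) := by positivity
        linarith
    _ ≤ Real.exp (n * Real.log m) * Real.exp ((a - b) / 2) := by gcongr
    _ = Real.exp (n * Real.log m + (a - b) / 2) := (Real.exp_add _ _).symm
    _ ≤ Real.exp (Real.log ε) := by
        rw [Real.exp_le_exp]
        rw [one_div, Real.log_inv] at hbL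
        linarith
    _ = ε := Real.exp_log hε
end
end
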